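/- arXiv:2504.06565 — 5 statements merged into one kernel-verified Lean document; each statement's English description precedes it below -/
import Mathlib

section
/- Let β > 0 and let u0, k be real numbers with 0 < u0 < k < 2u0. If real numbers u, w satisfy 0 < w < u0 < u < k and Φ(u) = Φ(w), then u·f(u) + w·f(w) < 0. -/
/-- `Φ β u0 k t = β(−t⁴/4 + ((k+u0)/3)t³ − (k·u0/2)t²)`. -/
noncomputable def Phi (β u0 k t : ℝ) : ℝ :=
  β * (-(t ^ 4) / 4 + ((k + u0) / 3) * t ^ 3 - (k * u0 / 2) * t ^ 2)

/-- `f u0 k t = (t − u0)(k − t)`. -/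
noncomputable def f (u0 k t : ℝ) : ℝ := (t - u0) * (k - t)

/-- The difference quotient of `Phi 1 u0 k` between `w` and `u`. -/
noncomputable def meanSlope (u0 k u w : ℝ) : ℝ :=
  -((u + w) * (u ^ 2 + w ^ 2)) / 4 + (k + u0) / 3 * (u ^ 2 + u * w + w ^ 2) - k * u0 / 2 * (u + w)

lemma Phi_sub_Phi (β u0 k u w : ℝ) :
    Phi β u0 k u - Phi β u0 k w = β * (u - w) * meanSlope u0 k u w := by
  unfold Phi meanSlope
  ring

/-- The trapezoidal rule for the cubic `t * f u0 k t`, whose error term is exact. -/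
lemma mul_f_add_mul_f (u0 k u w : ℝ) :
    u * f u0 k u + w * f u0 k w =
      2 * meanSlope u0 k u w - (u - w) ^ 2 / 6 * (3 * (u + w) - 2 * (k + u0)) := by
  unfold f meanSlope
  ring

/-- If the mean slope vanishes, the midpoint of `w` and `u` lies to the right of the inflection
point `(k + u0) / 3` of `t * f u0 k t`. -/
lemma inflection_lt_midpoint {u0 k u w : ℝ} (hk : u0 < k) (hk2 : k < 2 * u0) (hu : 0 < u)
    (hw : 0 < w) (h : meanSlope u0 k u w = 0) : 0 < 3 * (u + w) - 2 * (k + u0) := by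
  have hdisc : 0 < (2 * k - u0) * (2 * u0 - k) := mul_pos (by linarith) (by linarith)
  have hquad : 0 < (u + w) ^ 2 / 4 - (k + u0) / 3 * (u + w) + k * u0 / 2 := by
    nlinarith [sq_nonneg ((u + w) / 2 - (k + u0) / 3)]
  have key : u * w * (3 * (u + w) - 2 * (k + u0)) =
      6 * ((u + w) * ((u + w) ^ 2 / 4 - (k + u0) / 3 * (u + w) + k * u0 / 2)) := by
    unfold meanSlope at h
    linear_combination 6 * h
  have hpos : 0 < u * w * (3 * (u + w) - 2 * (k + u0)) := by
    rw [key]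
    positivity
  exact pos_of_mul_pos_right hpos (mul_pos hu hw).le

theorem stmt_2 (β u0 k u w : ℝ) (hβ : 0 < β) (h1 : 0 < u0) (h2 : u0 < k) (h3 : k < 2 * u0)
    (hw0 : 0 < w) (hwu0 : w < u0) (hu0u : u0 < u) (huk : u < k)
    (hΦ : Phi β u0 k u = Phi β u0 k w) :
    u * f u0 k u + w * f u0 k w < 0 := by
  have hu : 0 < u := h1.trans hu0u
  have hsub : 0 < u - w := by linarith
  have hslope : meanSlope u0 k u w = 0 := by
    have h := Phi_sub_Phi β u0 k u w
    rw [hΦ, sub_self] at h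
    exact (mul_eq_zero.mp h.symm).resolve_left (mul_pos hβ hsub).ne'
  have hmid := inflection_lt_midpoint h2 h3 hu hw0 hslope
  have herr : 0 < (u - w) ^ 2 / 6 * (3 * (u + w) - 2 * (k + u0)) := by positivity
  rw [mul_f_add_mul_f, hslope]
  linarith
end

section
/- Let β > 0 and let u0, k be real numbers with k > 0 and u0 < −k. If real numbers u, w satisfy u0 < w < 0 < u < k and Φ(u) = Φ(w), then u·f(u) + w·f(w) < 0. -/
/-- If `v - u ≥ 2 (a - k) / 3`, the quotient of `Φ(-v) - Φ(u)` by `u + v` (up to a positive factor,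
with `u0 = -a`) is positive. -/
lemma quotient_pos {a k u v : ℝ} (hk : 0 < k) (hka : k < a) (hu : 0 < u) (huk : u < k)
    (hva : v < a) (h : 2 * (a - k) / 3 ≤ v - u) :
    0 < 2 * (a - k) / 3 * (u ^ 2 - u * v + v ^ 2)
      - (v - u) * ((u ^ 2 + v ^ 2) / 2 - a * k) := by
  obtain ⟨s, rfl⟩ : ∃ s, v = u + s := ⟨v - u, by ring⟩
  obtain ⟨d, rfl⟩ : ∃ d, a = k + d := ⟨a - k, by ring⟩
  have hd : 0 < d := by linarith
  have hs : 2 * d / 3 ≤ s := by linarith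
  have hs0 : 0 < s := by linarith
  rcases le_total s d with hsd | hsd
  · have hq : u * (u + s) ≤ k * (k + s) := by gcongr
    have hmul := mul_nonneg (sub_nonneg.2 hs) (sub_nonneg.2 hq)
    have h₁ : 0 < k ^ 2 * d := by positivity
    have h₂ : 0 ≤ k * s * (d - s) := mul_nonneg (by positivity) (by linarith)
    have h₃ : 0 ≤ s ^ 2 * (d - s) := mul_nonneg (by positivity) (by linarith)
    have h₄ : 0 < k * s * d := by positivity
    have h₅ : 0 < s ^ 2 * d := by positivity
    nlinarith
  · obtain ⟨a, rfl⟩ : ∃ a, k = a - d := ⟨k + d, by ring⟩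
    have hq : u * (u + s) ≤ (a - s) * a :=
      mul_le_mul (by linarith) (by linarith) (by linarith) (by linarith)
    have hmul := mul_nonneg (sub_nonneg.2 hs) (sub_nonneg.2 hq)
    have hsa : 0 < a - s := by linarith
    have h₁ : 0 < d * (2 * a - s) ^ 2 := mul_pos hd (pow_pos (by linarith) 2)
    have h₂ : 0 ≤ (s - d) * (s * (2 * a - s)) :=
      mul_nonneg (by linarith) (mul_nonneg hs0.le (by linarith))
    nlinarith

theorem stmt_3 (β u0 k u w : ℝ) (hβ : 0 < β) (hk : 0 < k) (hu0 : u0 < -k)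
    (hw1 : u0 < w) (hw0 : w < 0) (hu0u : 0 < u) (huk : u < k)
    (hΦ : Phi β u0 k u = Phi β u0 k w) :
    u * f u0 k u + w * f u0 k w < 0 := by
  have hG : (u - w) * (2 * (-u0 - k) / 3 * (u ^ 2 - u * (-w) + (-w) ^ 2)
      - (-w - u) * ((u ^ 2 + (-w) ^ 2) / 2 - -u0 * k)) = 0 := by
    have := mul_left_cancel₀ hβ.ne' hΦ
    linear_combination (-2) * this
  have hQ := (mul_eq_zero.1 hG).resolve_left (by linarith)
  have hlt : -w - u < 2 * (-u0 - k) / 3 := by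
    by_contra! h
    exact (quotient_pos hk (by linarith) hu0u huk (by linarith) h).ne' hQ
  have hpos : 0 < (2 * (-u0 - k) / 3 - (-w - u)) * (u - w) ^ 2 :=
    mul_pos (by linarith) (pow_pos (by linarith) 2)
  unfold f
  linarith
end

section
/- Let β > 0 and let u0, k be real numbers with −k < u0 < 0 (so k > 0). If real numbers u, w satisfy u0 < w < 0 < u < k and Φ(u) = Φ(w), then u·f(u) + w·f(w) > 0. -/
theorem mul_f_pos {u0 k t : ℝ} (hu0 : u0 < 0) (ht0 : 0 < t) (htk : t < k) :
    0 < t * f u0 k t :=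
  mul_pos ht0 (mul_pos (by linarith) (by linarith))

/-- Simpson's rule is exact for the cubic `β t f(t)`, the derivative of `Φ`. -/
theorem Phi_sub_Phi_s4 (β u0 k x y : ℝ) :
    Phi β u0 k y - Phi β u0 k x = β * ((y - x) / 6 *
      (x * f u0 k x + 4 * ((x + y) / 2 * f u0 k ((x + y) / 2)) + y * f u0 k y)) := by
  simp only [Phi, f]
  ring

theorem Phi_le_Phi {β u0 k x y : ℝ} (hβ : 0 < β) (hu0 : u0 < 0) (hx : 0 < x) (hxy : x ≤ y)
    (hy : y < k) : Phi β u0 k x ≤ Phi β u0 k y := by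
  have hfx := mul_f_pos hu0 hx (hxy.trans_lt hy)
  have hfy := mul_f_pos hu0 (hx.trans_le hxy) hy
  have hfm := mul_f_pos (k := k) (t := (x + y) / 2) hu0 (by linarith) (by linarith)
  rw [← sub_nonneg, Phi_sub_Phi_s4]
  exact mul_nonneg hβ.le (mul_nonneg (by linarith) (by linarith))

/-- `Φ` compared at two points symmetric about the zero `(k + u0) / 3` of the third
derivative of `Φ`. -/
theorem Phi_reflect_sub_Phi (β u0 k w : ℝ) :
    Phi β u0 k (2 * ((k + u0) / 3) - w) - Phi β u0 k w =
      β * (2 * ((k + u0) / 3 - w) * ((k + u0) / 3 * f u0 k ((k + u0) / 3))) := by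
  simp only [Phi, f]
  ring

theorem add_lt_of_Phi_eq {β u0 k u w : ℝ} (hβ : 0 < β) (h1 : -k < u0) (h2 : u0 < 0)
    (hw0 : w < 0) (huk : u < k) (hΦ : Phi β u0 k u = Phi β u0 k w) :
    u + w < 2 * ((k + u0) / 3) := by
  by_contra! h
  have hle := Phi_le_Phi (x := 2 * ((k + u0) / 3) - w) hβ h2 (by linarith) (by linarith) huk
  have hc := mul_f_pos (k := k) (t := (k + u0) / 3) h2 (by linarith) (by linarith)
  have hpos := mul_pos hβ
    (mul_pos (show 0 < 2 * ((k + u0) / 3 - w) by linarith) hc)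
  rw [← Phi_reflect_sub_Phi] at hpos
  linarith

theorem mul_f_add_mul_f_of_Phi_eq {β u0 k u w : ℝ} (hβ : β ≠ 0) (huw : u ≠ w)
    (hΦ : Phi β u0 k u = Phi β u0 k w) :
    u * f u0 k u + w * f u0 k w = (u - w) ^ 2 * ((k + u0) / 3 - (u + w) / 2) := by
  have hsub := Phi_sub_Phi_s4 β u0 k w u
  rw [hΦ, sub_self, eq_comm, mul_eq_zero_iff_left hβ, mul_eq_zero_iff_left
    (div_ne_zero (sub_ne_zero.mpr huw) (by norm_num))] at hsub
  simp only [f] at hsub ⊢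
  linear_combination (1 / 3) * hsub

theorem stmt_4 (β u0 k u w : ℝ) (hβ : 0 < β) (h1 : -k < u0) (h2 : u0 < 0)
    (hw1 : u0 < w) (hw0 : w < 0) (hu0u : 0 < u) (huk : u < k)
    (hΦ : Phi β u0 k u = Phi β u0 k w) :
    u * f u0 k u + w * f u0 k w > 0 := by
  rw [mul_f_add_mul_f_of_Phi_eq hβ.ne' (hw0.trans hu0u).ne' hΦ]
  have hlt := add_lt_of_Phi_eq hβ h1 h2 hw0 huk hΦ
  exact mul_pos (pow_pos (by linarith) 2) (by linarith)
end

section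
/- Let β > 0 and let u0, k be real numbers with k > 0 and u0 < 0, and suppose real numbers u, w satisfy u0 < w < 0 < u < k and Φ(u) = Φ(w). Then: (i) if −k < u0 then u + w < 0; (ii) if u0 < −k then u + w > 0. -/
/-- `Φ` is monotone on `[0, k]`. -/
theorem Phi_le_Phi_s6 {β u0 k v u : ℝ} (hβ : 0 ≤ β) (hu0 : u0 ≤ 0) (hv : 0 ≤ v) (hvu : v ≤ u)
    (huk : u ≤ k) : Phi β u0 k v ≤ Phi β u0 k u := by
  have hu : 0 ≤ u := hv.trans hvu
  have h_cubic : 0 ≤ u ^ 3 + u ^ 2 * v + u * v ^ 2 - 3 * v ^ 3 := by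
    have : 0 ≤ (u - v) * (u ^ 2 + 2 * u * v + 3 * v ^ 2) :=
      mul_nonneg (sub_nonneg.2 hvu) (by positivity)
    linarith
  have h_quad : 0 ≤ u ^ 2 + u * v - 2 * v ^ 2 := by
    have : 0 ≤ (u - v) * (u + 2 * v) := mul_nonneg (sub_nonneg.2 hvu) (by positivity)
    linarith
  have h_k : 0 ≤ (k - u) * (u ^ 2 + u * v + v ^ 2) :=
    mul_nonneg (sub_nonneg.2 huk) (by positivity)
  have h_u0 : 0 ≤ -u0 * (3 * (k - u) * (u + v) + (u ^ 2 + u * v - 2 * v ^ 2)) :=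
    mul_nonneg (neg_nonneg.2 hu0)
      (add_nonneg (mul_nonneg (mul_nonneg (by norm_num) (sub_nonneg.2 huk)) (by positivity))
        h_quad)
  have h_diff : 0 ≤ β * ((u - v) * ((u ^ 3 + u ^ 2 * v + u * v ^ 2 - 3 * v ^ 3) / 12
      + (k - u) * (u ^ 2 + u * v + v ^ 2) / 3
      + -u0 * (3 * (k - u) * (u + v) + (u ^ 2 + u * v - 2 * v ^ 2)) / 6)) :=
    mul_nonneg hβ (mul_nonneg (sub_nonneg.2 hvu) (by linarith))
  unfold Phi
  linarith

theorem Phi_neg (β u0 k t : ℝ) : Phi β u0 k (-t) = Phi β (-k) (-u0) t := by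
  unfold Phi
  ring

theorem Phi_neg_lt_Phi {β u0 k t : ℝ} (hβ : 0 < β) (hk : -k < u0) (ht : 0 < t) :
    Phi β u0 k (-t) < Phi β u0 k t := by
  have h_sum : 0 < k + u0 := by linarith
  have : 0 < β * ((k + u0) * t ^ 3) := by positivity
  unfold Phi
  linarith

/-- If `-k < u0`, points of equal `Φ`-value on opposite sides of `0` have negative sum. -/
theorem add_neg_of_Phi_eq {β u0 k u w : ℝ} (hβ : 0 < β) (hu0 : u0 ≤ 0) (hw : w < 0)
    (huk : u ≤ k) (hΦ : Phi β u0 k u = Phi β u0 k w) (hk : -k < u0) : u + w < 0 := by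
  by_contra! h
  have h_mono : Phi β u0 k (-w) ≤ Phi β u0 k u :=
    Phi_le_Phi_s6 hβ.le hu0 (by linarith) (by linarith) huk
  have h_lt := Phi_neg_lt_Phi hβ hk (neg_pos.2 hw)
  rw [neg_neg] at h_lt
  linarith

theorem stmt_6 (β u0 k u w : ℝ) (hβ : 0 < β) (hk : 0 < k) (hu0 : u0 < 0)
    (hw1 : u0 < w) (hw0 : w < 0) (hu0u : 0 < u) (huk : u < k)
    (hΦ : Phi β u0 k u = Phi β u0 k w) :
    (-k < u0 → u + w < 0) ∧ (u0 < -k → u + w > 0) := by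
  refine ⟨add_neg_of_Phi_eq hβ hu0.le hw0 huk.le hΦ, fun h => ?_⟩
  have h_refl : Phi β (-k) (-u0) (-w) = Phi β (-k) (-u0) (-u) := by
    rw [← Phi_neg, ← Phi_neg, neg_neg, neg_neg, hΦ]
  have := add_neg_of_Phi_eq hβ (neg_nonpos.2 hk.le) (neg_neg_of_pos hu0u)
    (neg_le_neg hw1.le) h_refl (by linarith)
  linarith
end

section
/- Let u0, k be real numbers with 0 < u0 < k < 2u0, and define F(u,w) := (u + w)·(−((k + u0)/3)·(u + w) + k·u0 + u·w) − (2/3)·(k + u0)·u·w. Then F(u,w) ≤ 0 for every (u,w) in the closed triangular region R determined by the inequalities u + w ≥ 2u0, w ≤ u0, and u ≤ k; moreover F(u,w) < 0 for every (u,w) in R with (u,w) ≠ (u0,u0). -/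
/-- `F u0 k u w := (u + w)(−((k+u0)/3)(u+w) + k·u0 + u·w) − (2/3)(k+u0)·u·w`. -/
noncomputable def F (u0 k u w : ℝ) : ℝ :=
  (u + w) * (-((k + u0) / 3) * (u + w) + k * u0 + u * w) - (2 / 3) * (k + u0) * (u * w)

/-- At fixed `u + w`, `F` is affine in `u * w`: the last term compares with the point of the
edge `w = u0` having the same sum of coordinates. -/
theorem F_eq (u0 k u w : ℝ) :
    F u0 k u w =
      -((u + w - 2 * u0) * ((k - u0) * u0 - (u + w - 2 * u0) * (2 * u0 - k) / 3)) -
        (u + w - 2 / 3 * (k + u0)) * ((u0 - w) * (u - u0)) := by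
  unfold F
  ring

theorem F_neg {u0 k u w : ℝ} (h1 : 0 < u0) (h2 : u0 < k) (h3 : k < 2 * u0)
    (hs : 2 * u0 ≤ u + w) (hw : w ≤ u0) (hu : u ≤ k) (hne : (u, w) ≠ (u0, u0)) :
    F u0 k u w < 0 := by
  have hedge : 0 < (k - u0) * u0 - (u + w - 2 * u0) * (2 * u0 - k) / 3 := by
    nlinarith [mul_pos (sub_pos.2 h2) h1, mul_pos (sub_pos.2 h2) (sub_pos.2 h2),
      mul_nonneg (show 0 ≤ k - u0 - (u + w - 2 * u0) by linarith) (sub_pos.2 h3).le]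
  have hcoef : 0 < u + w - 2 / 3 * (k + u0) := by linarith
  rw [F_eq]
  rcases hw.lt_or_eq with hlt | rfl
  · have := mul_nonneg (sub_nonneg.2 hs) hedge.le
    have := mul_pos hcoef (mul_pos (sub_pos.2 hlt) (show 0 < u - u0 by linarith))
    linarith
  · have hlt : w < u := lt_of_le_of_ne (by linarith) fun h => hne (by rw [h])
    have := mul_pos (show 0 < u + w - 2 * w by linarith) hedge
    simpa using this

theorem stmt_18 (u0 k : ℝ) (h1 : 0 < u0) (h2 : u0 < k) (h3 : k < 2 * u0) :
    (∀ u w : ℝ, 2 * u0 ≤ u + w → w ≤ u0 → u ≤ k → F u0 k u w ≤ 0) ∧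
    (∀ u w : ℝ, 2 * u0 ≤ u + w → w ≤ u0 → u ≤ k → (u, w) ≠ (u0, u0) → F u0 k u w < 0) := by
  refine ⟨fun u w hs hw hu => ?_, fun u w hs hw hu hne => F_neg h1 h2 h3 hs hw hu hne⟩
  by_cases hne : (u, w) = (u0, u0)
  · obtain ⟨rfl, rfl⟩ := Prod.mk.inj hne
    rw [F_eq]
    apply le_of_eq
    ring
  · exact (F_neg h1 h2 h3 hs hw hu hne).le
end
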